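/- Let β ∈ (0, 1/2^{|S|}) and ε ∈ (0, β(1−β)/(L·|S|⁴)). Let q be an irreducible transition matrix on S and let q̂ be a transition matrix that is (ε,β)-close to q (so q̂ is irreducible). Then for every nonempty proper subset C of S, every s ∈ C and every t ∉ C, |Q_{s,q}(t|C) − Q_{s,q̂}(t|C)| < 12βL. -/

import Mathlib

open Finset

namespace PerturbedMC

variable {S : Type*} [Fintype S] [DecidableEq S]

/-- `q` is a (row-stochastic) transition matrix on `S`: `q s t` is the probability of moving
from `s` to `t`. -/
def IsTransition (q : Matrix S S ℝ) : Prop :=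
  (∀ s t, 0 ≤ q s t) ∧ ∀ s, ∑ t, q s t = 1

/-- `q` is irreducible. -/
def IsIrreducible (q : Matrix S S ℝ) : Prop :=
  ∀ s t, ∃ n : ℕ, 1 ≤ n ∧ 0 < (q ^ n) s t

/-- `μ` is a stationary distribution of `q`. -/
def IsStationary (q : Matrix S S ℝ) (μ : S → ℝ) : Prop :=
  (∀ s, 0 ≤ μ s) ∧ (∑ s, μ s = 1) ∧ ∀ t, ∑ s, μ s * q s t = μ t

/-- The combinatorial constant `L = ∑_{n=1}^{|S|-1} C(|S|,n) · n^{|S|}`. -/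
def Lconst (S : Type*) [Fintype S] : ℕ :=
  ∑ n ∈ Finset.Ico 1 (Fintype.card S), (Fintype.card S).choose n * n ^ Fintype.card S

/-- `ζ_q`: the minimal stationary outflow over nonempty proper subsets of `S`. -/
noncomputable def zeta (q : Matrix S S ℝ) (μ : S → ℝ) : ℝ :=
  sInf {x : ℝ | ∃ C : Finset S, C.Nonempty ∧ C ≠ Finset.univ ∧
    x = ∑ s ∈ C, μ s * ∑ t ∈ Cᶜ, q s t}

/-- `ζ_q^1`: the minimal stationary outflow over nonempty proper subsets of `S₁`. -/
noncomputable def zeta1 (q : Matrix S S ℝ) (μ : S → ℝ) (S1 : Finset S) : ℝ :=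
  sInf {x : ℝ | ∃ C : Finset S, C.Nonempty ∧ C ⊂ S1 ∧
    x = ∑ s ∈ C, μ s * ∑ t ∈ Cᶜ, q s t}

/-- `q̂` is `(ε,β)`-close to `q`, relative to the threshold `z` (`z = ζ_q` or `z = ζ_q^1`):
`|q̂(t|s) − q(t|s)| ≤ β·q(t|s)` whenever `μ_s q(t|s) ≥ ε·z` or `μ_s q̂(t|s) ≥ ε·z`. -/
def IsClose (q qh : Matrix S S ℝ) (μ : S → ℝ) (z ε β : ℝ) : Prop :=
  ∀ s t, (ε * z ≤ μ s * q s t ∨ ε * z ≤ μ s * qh s t) → |qh s t - q s t| ≤ β * q s t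

/-- The substochastic `C × C` restriction `q_C` of `q`. -/
def subMat (q : Matrix S S ℝ) (C : Finset S) : Matrix S S ℝ :=
  fun u v => if u ∈ C ∧ v ∈ C then q u v else 0

/-- The exit distribution `Q_{s,q}(t|C) = Σ_{n≥0} Σ_{u∈C} (q_C^n)(u|s)·q(t|u)`. -/
noncomputable def exitProb (q : Matrix S S ℝ) (C : Finset S) (s t : S) : ℝ :=
  ∑' n : ℕ, ∑ u ∈ C, ((subMat q C ^ n : Matrix S S ℝ) s u) * q u t

/-- The expected exit time `E_{s,q}[T_{C̄}] = Σ_{n≥0} Σ_{u∈C} (q_C^n)(u|s) ∈ [0,∞]`. -/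
noncomputable def expExit (q : Matrix S S ℝ) (C : Finset S) (s : S) : ENNReal :=
  ∑' n : ℕ, ENNReal.ofReal (∑ u ∈ C, (subMat q C ^ n : Matrix S S ℝ) s u)

/-- `g` has a cycle within `C`. -/
def HasCycle (C : Finset S) (g : S → S) : Prop :=
  ∃ (k : ℕ) (f : ℕ → S), 0 < k ∧ f k = f 0 ∧ (∀ i < k, f i ∈ C) ∧ ∀ i < k, g (f i) = f (i + 1)

/-- `g` is a `C`-graph (the values of `g` outside `C` are irrelevant). -/
def IsCGraph (C : Finset S) (g : S → S) : Prop := ¬ HasCycle C g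

/-- `s` leads to `t` along `g`: `t` is the first state outside `C` on the `g`-orbit of `s`. -/
def LeadsTo (C : Finset S) (g : S → S) (s t : S) : Prop :=
  ∃ n : ℕ, g^[n] s = t ∧ t ∉ C ∧ ∀ m < n, g^[m] s ∈ C

/-- The weight `p(g) = Π_{s∈C} q(g(s)|s)` of a `C`-graph under `q`. -/
def wt (q : Matrix S S ℝ) (C : Finset S) (g : S → S) : ℝ := ∏ s ∈ C, q s (g s)

/-- `G(C)`: the canonical representatives of `C`-graphs, namely the maps `S → S` that are
`C`-graphs and are the identity outside `C`. -/
noncomputable def Gset (C : Finset S) : Finset (S → S) :=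
  @Finset.filter _ (fun g => IsCGraph C g ∧ ∀ s ∉ C, g s = s) (Classical.decPred _) Finset.univ

/-- `G_{s,t}(C)`: the `C`-graphs along which `s` leads to `t`. -/
noncomputable def GsetLead (C : Finset S) (s t : S) : Finset (S → S) :=
  @Finset.filter _ (fun g => LeadsTo C g s t) (Classical.decPred _) (Gset C)

/-- `g` is an `η`-maximal `C`-graph under `q`: `p(g) ≥ η · max_{g' ∈ G(C)} p(g')`. -/
def IsMaximal (q : Matrix S S ℝ) (C : Finset S) (η : ℝ) (g : S → S) : Prop :=
  IsCGraph C g ∧ ∀ g', IsCGraph C g' → η * wt q C g' ≤ wt q C g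

/-- `H = G^β(C) ∪ Ĝ^β(C)` as a finset of canonical representatives. -/
noncomputable def Hset (q qh : Matrix S S ℝ) (C : Finset S) (β : ℝ) : Finset (S → S) :=
  @Finset.filter _ (fun g => IsMaximal q C β g ∨ IsMaximal qh C β g)
    (Classical.decPred _) (Gset C)

/-- The mixing hypothesis with parameter `a` on `S₁`: for all `s,t ∈ S₁`, the probability
that the chain started at `s`, from its first step onward, reaches `t` before reaching any
state of `S \ S₁`, is at least `a`. -/
def Mixing (q : Matrix S S ℝ) (S1 : Finset S) (a : ℝ) : Prop :=
  ∀ s ∈ S1, ∀ t ∈ S1,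
    a ≤ q s t + ∑ u ∈ S1.erase t, q s u * exitProb q (S1.erase t) u t

/-- `R` is a recurrent class for `q`. -/
def IsRecClass (q : Matrix S S ℝ) (R : Finset S) : Prop :=
  (∀ s ∈ R, ∑ t ∈ Rᶜ, q s t = 0) ∧
    ∀ s ∈ R, ∀ t ∈ R, ∃ n : ℕ, 1 ≤ n ∧ 0 < (q ^ n) s t

lemma subMat_pow_nonneg {p : Matrix S S ℝ} (hp : IsTransition p) (C : Finset S) (n : ℕ) (s u : S) :
    0 ≤ (subMat p C ^ n) s u := by
  induction n generalizing u with
  | zero => rw [pow_zero, Matrix.one_apply]; split_ifs <;> norm_num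
  | succ n ih =>
    rw [pow_succ, Matrix.mul_apply]
    refine Finset.sum_nonneg fun w _ => mul_nonneg (ih w) ?_
    unfold subMat
    split_ifs
    exacts [hp.1 _ _, le_rfl]

lemma subMat_pow_succ_apply (p : Matrix S S ℝ) (C : Finset S) (n : ℕ) (s : S) {w : S}
    (hw : w ∈ C) :
    (subMat p C ^ (n + 1)) s w = ∑ u ∈ C, (subMat p C ^ n) s u * p u w := by
  rw [pow_succ, Matrix.mul_apply, ← Finset.sum_filter_add_sum_filter_not univ (· ∈ C)]
  have h2 : ∑ u with u ∉ C, (subMat p C ^ n) s u * subMat p C u w = 0 :=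
    Finset.sum_eq_zero fun u hu => by simp [subMat, (Finset.mem_filter.1 hu).2]
  rw [h2, add_zero, Finset.filter_univ_mem]
  exact Finset.sum_congr rfl fun u hu => by simp [subMat, hu, hw]

lemma subMat_pow_succ_apply' (p : Matrix S S ℝ) (C : Finset S) (n : ℕ) {s : S} (hs : s ∈ C)
    (u : S) :
    (subMat p C ^ (n + 1)) s u = ∑ w ∈ C, p s w * (subMat p C ^ n) w u := by
  rw [pow_succ', Matrix.mul_apply, ← Finset.sum_filter_add_sum_filter_not univ (· ∈ C)]
  have h2 : ∑ w with w ∉ C, subMat p C s w * (subMat p C ^ n) w u = 0 :=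
    Finset.sum_eq_zero fun w hw => by simp [subMat, (Finset.mem_filter.1 hw).2]
  rw [h2, add_zero, Finset.filter_univ_mem]
  exact Finset.sum_congr rfl fun w hw => by simp [subMat, hs, hw]

lemma subMat_pow_succ_apply_of_notMem (p : Matrix S S ℝ) (C : Finset S) (n : ℕ) {s : S}
    (hs : s ∉ C) (u : S) : (subMat p C ^ (n + 1)) s u = 0 := by
  rw [pow_succ', Matrix.mul_apply]
  exact Finset.sum_eq_zero fun w _ => by simp [subMat, hs]

/-- The expected number of visits to `u` among the first `n` steps of the chain started at `s`
and killed on leaving `C`. -/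
noncomputable def green (p : Matrix S S ℝ) (C : Finset S) (n : ℕ) (s u : S) : ℝ :=
  ∑ k ∈ Finset.range n, (subMat p C ^ k) s u

lemma green_nonneg {p : Matrix S S ℝ} (hp : IsTransition p) (C : Finset S) (n : ℕ) (s u : S) :
    0 ≤ green p C n s u :=
  Finset.sum_nonneg fun k _ => subMat_pow_nonneg hp C k s u

lemma green_succ (p : Matrix S S ℝ) (C : Finset S) (n : ℕ) (s u : S) :
    green p C (n + 1) s u = green p C n s u + (subMat p C ^ n) s u :=
  Finset.sum_range_succ _ _

lemma green_of_notMem (p : Matrix S S ℝ) (C : Finset S) (n : ℕ) {s u : S} (hs : s ∉ C)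
    (hu : u ∈ C) : green p C n s u = 0 := by
  refine Finset.sum_eq_zero fun k _ => ?_
  cases k with
  | zero => rw [pow_zero, Matrix.one_apply_ne]; rintro rfl; exact hs hu
  | succ k => exact subMat_pow_succ_apply_of_notMem p C k hs u

lemma green_sub_one_le {p : Matrix S S ℝ} (hp : IsTransition p) (C : Finset S) (n : ℕ) {s u : S}
    (hs : s ∈ C) (hu : u ∈ C) :
    green p C n s u - (if s = u then 1 else 0) ≤ ∑ w, p s w * green p C n w u := by
  have h1 : ∑ w, p s w * green p C n w u = ∑ w ∈ C, p s w * green p C n w u := by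
    symm
    refine Finset.sum_subset (Finset.subset_univ _) fun w _ hw => ?_
    rw [green_of_notMem p C n hw hu, mul_zero]
  have h2 : green p C (n + 1) s u = (if s = u then 1 else 0) + ∑ w ∈ C, p s w * green p C n w u := by
    unfold green
    rw [Finset.sum_range_succ', pow_zero, Matrix.one_apply, add_comm]
    congr 1
    simp_rw [Finset.mul_sum]
    rw [Finset.sum_comm]
    exact Finset.sum_congr rfl fun k _ => subMat_pow_succ_apply' p C k hs u
  have h3 := green_succ p C n s u
  have h4 := subMat_pow_nonneg hp C n s u
  rw [h1]
  linarith

/-- Dynkin's formula for the chain stopped on leaving `C`, at time `n`. -/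
lemma sum_green_mul_sub (p : Matrix S S ℝ) (C : Finset S) (n : ℕ) {s : S} (hs : s ∈ C)
    (F : S → ℝ) :
    ∑ u ∈ C, green p C n s u * (∑ w, p u w * F w - F u) =
      ∑ w ∈ Cᶜ, (∑ u ∈ C, green p C n s u * p u w) * F w +
        ∑ u ∈ C, (subMat p C ^ n) s u * F u - F s := by
  induction n with
  | zero => simp [green, Matrix.one_apply, hs]
  | succ n ih =>
    simp_rw [green_succ, add_mul, Finset.sum_add_distrib, add_mul, Finset.sum_add_distrib]
    rw [ih]
    have h1 : ∑ u ∈ C, (subMat p C ^ (n + 1)) s u * F u =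
        ∑ u ∈ C, (subMat p C ^ n) s u * ∑ w ∈ C, p u w * F w := by
      simp_rw [Finset.mul_sum]
      rw [Finset.sum_comm]
      refine Finset.sum_congr rfl fun w hw => ?_
      rw [subMat_pow_succ_apply p C n s hw, Finset.sum_mul]
      exact Finset.sum_congr rfl fun u _ => by ring
    have h2 : ∑ w ∈ Cᶜ, (∑ u ∈ C, (subMat p C ^ n) s u * p u w) * F w =
        ∑ u ∈ C, (subMat p C ^ n) s u * ∑ w ∈ Cᶜ, p u w * F w := by
      simp_rw [Finset.mul_sum, Finset.sum_mul]
      rw [Finset.sum_comm]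
      exact Finset.sum_congr rfl fun u _ => Finset.sum_congr rfl fun w _ => by ring
    rw [h1, h2]
    have h3 : ∀ u, ∑ w, p u w * F w = ∑ w ∈ C, p u w * F w + ∑ w ∈ Cᶜ, p u w * F w :=
      fun u => (Finset.sum_add_sum_compl C _).symm
    simp_rw [h3, mul_sub, mul_add, Finset.sum_sub_distrib, Finset.sum_add_distrib]
    ring

lemma sum_green_add_sum_subMat_pow {p : Matrix S S ℝ} (hp : IsTransition p) (C : Finset S) (n : ℕ)
    {s : S} (hs : s ∈ C) :
    ∑ w ∈ Cᶜ, (∑ u ∈ C, green p C n s u * p u w) + ∑ u ∈ C, (subMat p C ^ n) s u = 1 := by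
  have h := sum_green_mul_sub p C n hs fun _ => 1
  simp only [mul_one, hp.2, sub_self, mul_zero, Finset.sum_const_zero] at h
  linarith

lemma sum_green_mul_sub_le_one {p : Matrix S S ℝ} (hp : IsTransition p) (C : Finset S) (n : ℕ)
    {s : S} (hs : s ∈ C) {F : S → ℝ} (hF : ∀ w, F w ≤ F s + 1) :
    ∑ u ∈ C, green p C n s u * (∑ w, p u w * F w - F u) ≤ 1 := by
  rw [sum_green_mul_sub p C n hs F]
  have h1 : ∑ w ∈ Cᶜ, (∑ u ∈ C, green p C n s u * p u w) * F w ≤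
      ∑ w ∈ Cᶜ, (∑ u ∈ C, green p C n s u * p u w) * (F s + 1) :=
    Finset.sum_le_sum fun w _ => mul_le_mul_of_nonneg_left (hF w) <|
      Finset.sum_nonneg fun u _ => mul_nonneg (green_nonneg hp C n s u) (hp.1 u w)
  have h2 : ∑ u ∈ C, (subMat p C ^ n) s u * F u ≤ ∑ u ∈ C, (subMat p C ^ n) s u * (F s + 1) :=
    Finset.sum_le_sum fun u _ => mul_le_mul_of_nonneg_left (hF u) (subMat_pow_nonneg hp C n s u)
  rw [← Finset.sum_mul] at h1 h2
  have h3 := sum_green_add_sum_subMat_pow hp C n hs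
  have h4 : (∑ w ∈ Cᶜ, (∑ u ∈ C, green p C n s u * p u w)) * (F s + 1) +
      (∑ u ∈ C, (subMat p C ^ n) s u) * (F s + 1) = F s + 1 := by
    rw [← add_mul, h3, one_mul]
  linarith

lemma sum_range_exit (p : Matrix S S ℝ) (C : Finset S) (n : ℕ) (s t : S) :
    ∑ k ∈ Finset.range n, ∑ u ∈ C, (subMat p C ^ k) s u * p u t =
      ∑ u ∈ C, green p C n s u * p u t := by
  rw [Finset.sum_comm]
  simp_rw [green, Finset.sum_mul]

lemma exit_term_nonneg {p : Matrix S S ℝ} (hp : IsTransition p) (C : Finset S) (s t : S) (n : ℕ) :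
    0 ≤ ∑ u ∈ C, (subMat p C ^ n) s u * p u t :=
  Finset.sum_nonneg fun u _ => mul_nonneg (subMat_pow_nonneg hp C n s u) (hp.1 u t)

lemma sum_range_exit_le_one {p : Matrix S S ℝ} (hp : IsTransition p) (C : Finset S) {s t : S}
    (hs : s ∈ C) (ht : t ∉ C) (n : ℕ) :
    ∑ k ∈ Finset.range n, ∑ u ∈ C, (subMat p C ^ k) s u * p u t ≤ 1 := by
  have h0 : ∀ w, 0 ≤ ∑ u ∈ C, green p C n s u * p u w := fun w =>
    Finset.sum_nonneg fun u _ => mul_nonneg (green_nonneg hp C n s u) (hp.1 u w)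
  have h1 := Finset.single_le_sum (f := fun w => ∑ u ∈ C, green p C n s u * p u w)
    (fun w _ => h0 w) (Finset.mem_compl.2 ht)
  have h2 := Finset.sum_nonneg fun u (_ : u ∈ C) => subMat_pow_nonneg hp C n s u
  have h3 := sum_green_add_sum_subMat_pow hp C n hs
  rw [sum_range_exit]
  linarith

lemma summable_exit {p : Matrix S S ℝ} (hp : IsTransition p) (C : Finset S) {s t : S}
    (hs : s ∈ C) (ht : t ∉ C) :
    Summable fun n : ℕ => ∑ u ∈ C, (subMat p C ^ n) s u * p u t :=
  summable_of_sum_range_le (exit_term_nonneg hp C s t) (sum_range_exit_le_one hp C hs ht)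

lemma exitProb_nonneg {p : Matrix S S ℝ} (hp : IsTransition p) (C : Finset S) (s t : S) :
    0 ≤ exitProb p C s t :=
  tsum_nonneg (exit_term_nonneg hp C s t)

lemma exitProb_le_one {p : Matrix S S ℝ} (hp : IsTransition p) (C : Finset S) {s t : S}
    (hs : s ∈ C) (ht : t ∉ C) : exitProb p C s t ≤ 1 :=
  Real.tsum_le_of_sum_range_le (exit_term_nonneg hp C s t) (sum_range_exit_le_one hp C hs ht)

/-- First-step analysis of the exit distribution. -/
lemma exitProb_eq {p : Matrix S S ℝ} (hp : IsTransition p) (C : Finset S) {s t : S}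
    (hs : s ∈ C) (ht : t ∉ C) :
    exitProb p C s t = p s t + ∑ w ∈ C, p s w * exitProb p C w t := by
  rw [exitProb, (summable_exit hp C hs ht).tsum_eq_zero_add]
  congr 1
  · simp [Matrix.one_apply, hs]
  · have h : ∀ n, ∑ u ∈ C, (subMat p C ^ (n + 1)) s u * p u t =
        ∑ w ∈ C, p s w * ∑ u ∈ C, (subMat p C ^ n) w u * p u t := fun n => by
      simp_rw [subMat_pow_succ_apply' p C n hs, Finset.sum_mul, Finset.mul_sum]
      rw [Finset.sum_comm]
      exact Finset.sum_congr rfl fun u _ => Finset.sum_congr rfl fun w _ => by ring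
    simp_rw [h]
    rw [Summable.tsum_finsetSum fun w hw => (summable_exit hp C hw ht).mul_left _]
    exact Finset.sum_congr rfl fun w _ => tsum_mul_left

/-- Every value `f v` of a function on a finite type has a successor value `d v`, and differences
of values are sums of successive gaps. -/
lemma exists_succ_value (f : S → ℝ) :
    ∃ d : S → ℝ, (∀ v, f v ≤ d v) ∧ (∀ v w, f v < f w → d v ≤ f w) ∧
      ∀ u w, f w - f u ≤ ∑ v with f u ≤ f v ∧ f v < f w, (d v - f v) := by
  classical
  have h1 : ∀ v, ∃ d, f v ≤ d ∧ (∀ w, f v < f w → d ≤ f w) ∧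
      ∀ w, f v < f w → ∃ v', f v < f v' ∧ f v' = d := by
    intro v
    by_cases hne : (univ.filter fun w => f v < f w).Nonempty
    · obtain ⟨v', hv', hmin⟩ := Finset.exists_min_image _ f hne
      simp only [Finset.mem_filter, Finset.mem_univ, true_and] at hv' hmin
      exact ⟨f v', hv'.le, hmin, fun _ _ => ⟨v', hv', rfl⟩⟩
    · refine ⟨f v, le_rfl, fun w hw => ?_, fun w hw => ?_⟩ <;>
        exact absurd ⟨w, by simpa using hw⟩ hne
  choose d hd1 hd2 hd3 using h1
  refine ⟨d, hd1, hd2, fun u w => ?_⟩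
  induction hk : (univ.filter fun v => f u ≤ f v ∧ f v < f w).card using Nat.strong_induction_on
    generalizing u with
  | _ k ih =>
    rcases le_or_gt (f w) (f u) with h | h
    · exact (sub_nonpos.2 h).trans (Finset.sum_nonneg fun v _ => sub_nonneg.2 (hd1 v))
    · obtain ⟨u', hu', hdu⟩ := hd3 u w h
      have hsub : insert u (univ.filter fun v => f u' ≤ f v ∧ f v < f w) ⊆
          univ.filter fun v => f u ≤ f v ∧ f v < f w := by
        intro v hv
        simp only [Finset.mem_insert, Finset.mem_filter, Finset.mem_univ, true_and] at hv ⊢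
        rcases hv with rfl | hv
        · exact ⟨le_rfl, h⟩
        · exact ⟨hu'.le.trans hv.1, hv.2⟩
      have hnot : u ∉ univ.filter fun v => f u' ≤ f v ∧ f v < f w := by
        simp [hu']
      have hcard := Finset.card_le_card hsub
      rw [Finset.card_insert_of_notMem hnot] at hcard
      have h2 := ih _ (by omega) u' rfl
      have h3 := Finset.sum_le_sum_of_subset_of_nonneg hsub
        (f := fun v => d v - f v) fun v _ _ => sub_nonneg.2 (hd1 v)
      rw [Finset.sum_insert hnot] at h3
      linarith

lemma IsStationary.sum_mul_sub {T : Type*} [Fintype T] {q : Matrix T T ℝ} {μ : T → ℝ} (hμ : IsStationary q μ)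
    (F : T → ℝ) : ∑ v, μ v * (∑ w, q v w * F w - F v) = 0 := by
  simp_rw [mul_sub, Finset.sum_sub_distrib, Finset.mul_sum]
  rw [Finset.sum_comm, sub_eq_zero]
  refine Finset.sum_congr rfl fun w _ => ?_
  rw [← hμ.2.2 w, Finset.sum_mul]
  exact Finset.sum_congr rfl fun v _ => by ring

lemma sum_mul_sub_eq {T : Type*} [Fintype T] {p : Matrix T T ℝ} (hp : IsTransition p) (F : T → ℝ) (u : T) :
    ∑ w, p u w * F w - F u = ∑ w, p u w * (F w - F u) := by
  simp_rw [mul_sub, Finset.sum_sub_distrib]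
  rw [← Finset.sum_mul, hp.2, one_mul]

/-- If `g` vanishes off `C` and superharmonic on `C` up to a unit charge at `u`, then `g`
is bounded in terms of the stationary mass of `u` and the minimal outflow. -/
lemma mul_le_card_mul_of_sub_one_le {q : Matrix S S ℝ} {μ : S → ℝ} {z : ℝ} {C : Finset S}
    (hq : IsTransition q) (hμ : IsStationary q μ) (hz0 : 0 ≤ z)
    (hz : ∀ A : Finset S, A.Nonempty → A ≠ univ → z ≤ ∑ s ∈ A, μ s * ∑ t ∈ Aᶜ, q s t)
    (hC : C ≠ univ) (u : S) {g : S → ℝ} (hg0 : ∀ v ∉ C, g v = 0)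
    (hg : ∀ v ∈ C, g v - (if v = u then 1 else 0) ≤ ∑ w, q v w * g w) (s : S) :
    z * g s ≤ Fintype.card S * μ u := by
  obtain ⟨d, hd1, hd2, hd3⟩ := exists_succ_value g
  obtain ⟨x, hx⟩ : ∃ x, x ∉ C := by
    by_contra! h
    exact hC (Finset.eq_univ_iff_forall.2 h)
  have hgap : ∀ v, 0 ≤ g v → g v < g s → z * (d v - g v) ≤ μ u := by
    intro v hv0 hvs
    set A : Finset S := univ.filter fun y => g v < g y with hA
    have hmem : ∀ y, y ∈ A ↔ g v < g y := fun y => by simp [hA]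
    have hAC : ∀ y ∈ A, y ∈ C := fun y hy => by
      by_contra h
      have := (hmem y).1 hy
      rw [hg0 y h] at this
      linarith
    have hcut := hz A ⟨s, (hmem s).2 hvs⟩ fun h => hx (hAC x (h ▸ Finset.mem_univ x))
    have hst := hμ.sum_mul_sub fun y => max (g y - d v) 0
    have hpt : ∀ y, (if y ∈ A then (d v - g v) * (μ y * ∑ w ∈ Aᶜ, q y w) -
        μ y * (if y = u then 1 else 0) else 0) ≤
        μ y * (∑ w, q y w * max (g w - d v) 0 - max (g y - d v) 0) := by
      intro y
      by_cases hy : y ∈ A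
      · rw [if_pos hy]
        have hyd : d v ≤ g y := hd2 v y ((hmem y).1 hy)
        have h1 := hg y (hAC y hy)
        have h2 : ∑ w, q y w * (g w - d v) + ∑ w ∈ Aᶜ, q y w * (d v - g v) ≤
            ∑ w, q y w * max (g w - d v) 0 := by
          rw [← Finset.sum_add_sum_compl A, ← Finset.sum_add_sum_compl A
            fun w => q y w * max (g w - d v) 0, add_assoc, ← Finset.sum_add_distrib]
          refine add_le_add (Finset.sum_le_sum fun w _ =>
            mul_le_mul_of_nonneg_left (le_max_left _ _) (hq.1 y w))
            (Finset.sum_le_sum fun w hw => ?_)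
          rw [← mul_add]
          refine mul_le_mul_of_nonneg_left ((?_ : _ ≤ (0 : ℝ)).trans (le_max_right _ _))
            (hq.1 y w)
          have := Finset.mem_compl.1 hw
          rw [hmem, not_lt] at this
          linarith
        simp_rw [mul_sub (q _ _) (g _), Finset.sum_sub_distrib, ← Finset.sum_mul, hq.2] at h2
        rw [max_eq_left (sub_nonneg.2 hyd)]
        have h3 := hμ.1 y
        rw [show ∀ a b c e : ℝ, a * (b * c) - b * e = b * (c * a - e) by intros; ring]
        refine mul_le_mul_of_nonneg_left ?_ h3
        linarith
      · rw [if_neg hy]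
        have hyv : g y ≤ g v := not_lt.1 fun h => hy ((hmem y).2 h)
        rw [max_eq_right (by linarith [hd1 v]), sub_zero]
        exact mul_nonneg (hμ.1 y) (Finset.sum_nonneg fun w _ =>
          mul_nonneg (hq.1 y w) (le_max_right _ _))
    have hsum := Finset.sum_le_sum fun y (_ : y ∈ univ) => hpt y
    rw [hst, ← Finset.sum_filter, Finset.filter_univ_mem, Finset.sum_sub_distrib,
      ← Finset.mul_sum] at hsum
    have hu : ∑ y ∈ A, μ y * (if y = u then 1 else 0) ≤ μ u := by
      simp only [mul_ite, mul_one, mul_zero, Finset.sum_ite_eq']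
      split_ifs
      exacts [le_rfl, hμ.1 u]
    have := mul_le_mul_of_nonneg_left hcut (sub_nonneg.2 (hd1 v))
    linarith
  have h1 := hd3 x s
  rw [hg0 x hx, sub_zero] at h1
  calc z * g s ≤ z * ∑ v with 0 ≤ g v ∧ g v < g s, (d v - g v) :=
        mul_le_mul_of_nonneg_left h1 hz0
    _ ≤ ∑ v with 0 ≤ g v ∧ g v < g s, μ u := by
        rw [Finset.mul_sum]
        refine Finset.sum_le_sum fun v hv => ?_
        simp only [Finset.mem_filter, Finset.mem_univ, true_and] at hv
        exact hgap v hv.1 hv.2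
    _ ≤ Fintype.card S * μ u := by
        rw [Finset.sum_const, nsmul_eq_mul]
        refine mul_le_mul_of_nonneg_right ?_ (hμ.1 u)
        exact_mod_cast Finset.card_le_univ _

/-- A closed set of an irreducible chain is empty or everything. -/
lemma IsIrreducible.eq_univ_of_closed {q : Matrix S S ℝ} (hq : IsIrreducible q) {A : Finset S}
    (hA : A.Nonempty) (hcl : ∀ s ∈ A, ∀ t ∉ A, q s t = 0) : A = univ := by
  obtain ⟨s, hs⟩ := hA
  refine Finset.eq_univ_iff_forall.2 fun t => ?_
  by_contra ht
  obtain ⟨n, -, hn⟩ := hq s t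
  have h : ∀ n : ℕ, ∀ t ∉ A, (q ^ n) s t = 0 := by
    intro n
    induction n with
    | zero =>
      intro t ht
      rw [pow_zero, Matrix.one_apply_ne]
      rintro rfl
      exact ht hs
    | succ n ih =>
      intro t ht
      rw [pow_succ, Matrix.mul_apply]
      refine Finset.sum_eq_zero fun w _ => ?_
      by_cases hw : w ∈ A
      · rw [hcl w hw t ht, mul_zero]
      · rw [ih w hw, zero_mul]
  exact hn.ne' (h n t ht)

lemma IsStationary.pos {q : Matrix S S ℝ} {μ : S → ℝ} (hμ : IsStationary q μ)
    (hq : IsTransition q) (hirr : IsIrreducible q) (s : S) : 0 < μ s := by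
  have hA : (univ.filter fun v => 0 < μ v) = univ := by
    refine hirr.eq_univ_of_closed ?_ fun v hv t ht => ?_
    · by_contra h
      rw [Finset.not_nonempty_iff_eq_empty, Finset.filter_eq_empty_iff] at h
      have h0 : ∑ v, μ v = 0 :=
        Finset.sum_eq_zero fun v hv => le_antisymm (not_lt.1 (h hv)) (hμ.1 v)
      linarith [hμ.2.1]
    · simp only [Finset.mem_filter, Finset.mem_univ, true_and, not_lt] at hv ht
      have h1 := Finset.single_le_sum (f := fun v => μ v * q v t)
        (fun v _ => mul_nonneg (hμ.1 v) (hq.1 v t)) (Finset.mem_univ v)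
      rw [hμ.2.2 t] at h1
      have h2 : μ v * q v t ≤ 0 := h1.trans ht
      exact le_antisymm (nonpos_of_mul_nonpos_right h2 hv) (hq.1 v t)
  simpa using Finset.eq_univ_iff_forall.1 hA s

lemma outflow_pos {q : Matrix S S ℝ} {μ : S → ℝ} (hμ : IsStationary q μ)
    (hq : IsTransition q) (hirr : IsIrreducible q) {A : Finset S} (hA : A.Nonempty)
    (hA' : A ≠ univ) : 0 < ∑ s ∈ A, μ s * ∑ t ∈ Aᶜ, q s t := by
  have hn : ∀ s ∈ A, 0 ≤ μ s * ∑ t ∈ Aᶜ, q s t := fun s _ =>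
    mul_nonneg (hμ.1 s) (Finset.sum_nonneg fun t _ => hq.1 s t)
  refine (Finset.sum_nonneg hn).lt_of_ne fun h => hA' (hirr.eq_univ_of_closed hA fun s hs t ht => ?_)
  have h1 := (Finset.sum_eq_zero_iff_of_nonneg hn).1 h.symm s hs
  have h2 := (mul_eq_zero.1 h1).resolve_left (hμ.pos hq hirr s).ne'
  exact (Finset.sum_eq_zero_iff_of_nonneg fun t _ => hq.1 s t).1 h2 t (Finset.mem_compl.2 ht)

lemma zeta_le {q : Matrix S S ℝ} {μ : S → ℝ} (hμ : IsStationary q μ) (hq : IsTransition q)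
    {A : Finset S} (hA : A.Nonempty) (hA' : A ≠ univ) :
    zeta q μ ≤ ∑ s ∈ A, μ s * ∑ t ∈ Aᶜ, q s t := by
  refine csInf_le ⟨0, ?_⟩ ⟨A, hA, hA', rfl⟩
  rintro x ⟨B, -, -, rfl⟩
  exact Finset.sum_nonneg fun s _ => mul_nonneg (hμ.1 s) (Finset.sum_nonneg fun t _ => hq.1 s t)

lemma zeta_pos {q : Matrix S S ℝ} {μ : S → ℝ} (hμ : IsStationary q μ) (hq : IsTransition q)
    (hirr : IsIrreducible q) {A : Finset S} (hA : A.Nonempty) (hA' : A ≠ univ) :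
    0 < zeta q μ := by
  have hfin : {x : ℝ | ∃ C : Finset S, C.Nonempty ∧ C ≠ Finset.univ ∧
      x = ∑ s ∈ C, μ s * ∑ t ∈ Cᶜ, q s t}.Finite :=
    (Set.finite_range fun C : Finset S => ∑ s ∈ C, μ s * ∑ t ∈ Cᶜ, q s t).subset <| by
      rintro x ⟨C, -, -, rfl⟩
      exact ⟨C, rfl⟩
  obtain ⟨C, h1, h2, h3⟩ := Set.Nonempty.csInf_mem (by exact ⟨_, A, hA, hA', rfl⟩) hfin
  rw [zeta, h3]
  exact outflow_pos hμ hq hirr h1 h2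

lemma green_le {q : Matrix S S ℝ} {μ : S → ℝ} (hμ : IsStationary q μ) (hq : IsTransition q)
    (hirr : IsIrreducible q) {C : Finset S} (hC : C.Nonempty) (hC' : C ≠ univ) (n : ℕ) (s : S)
    {u : S} (hu : u ∈ C) : zeta q μ * green q C n s u ≤ Fintype.card S * μ u :=
  mul_le_card_mul_of_sub_one_le hq hμ (zeta_pos hμ hq hirr hC hC').le
    (fun _ h h' => zeta_le hμ hq h h') hC' u (g := fun v => green q C n v u)
    (fun _ hv => green_of_notMem q C n hv hu) (fun _ hv => green_sub_one_le hq C n hv hu) s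

/-- Crossing the gap `(c, d)` increases `|· - (c + d) / 2|` by at least `d - c` beyond its linear
part. -/
lemma abs_sub_midpoint {c d x y : ℝ} (hcd : c ≤ d) (hx : c < x → d ≤ x) (hy : c < y → d ≤ y) :
    (if x ≤ c then -1 else 1) * (y - x) +
        (if (x ≤ c ∧ c < y) ∨ (y ≤ c ∧ c < x) then d - c else 0) ≤
      |y - (c + d) / 2| - |x - (c + d) / 2| := by
  rcases le_or_gt x c with h1 | h1 <;> rcases le_or_gt y c with h2 | h2
  · rw [if_pos h1, if_neg (by grind), abs_of_nonpos (by linarith : x - (c + d) / 2 ≤ 0)]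
    linarith [neg_abs_le (y - (c + d) / 2)]
  · have := hy h2
    rw [if_pos h1, if_pos (Or.inl ⟨h1, h2⟩), abs_of_nonpos (by linarith : x - (c + d) / 2 ≤ 0),
      abs_of_nonneg (by linarith : 0 ≤ y - (c + d) / 2)]
    linarith
  · have := hx h1
    rw [if_neg h1.not_ge, if_pos (Or.inr ⟨h2, h1⟩),
      abs_of_nonneg (by linarith : 0 ≤ x - (c + d) / 2),
      abs_of_nonpos (by linarith : y - (c + d) / 2 ≤ 0)]
    linarith
  · have := hx h1
    rw [if_neg h1.not_ge, if_neg (by grind), abs_of_nonneg (by linarith : 0 ≤ x - (c + d) / 2)]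
    linarith [le_abs_self (y - (c + d) / 2)]

/-- The expected total variation of `F` along the chain until it leaves `C` is controlled by the
expected total drift of `F`. -/
lemma sum_green_mul_abs_le {p : Matrix S S ℝ} (hp : IsTransition p) (C : Finset S) (n : ℕ)
    {s : S} (hs : s ∈ C) {F : S → ℝ} (hF0 : ∀ w, 0 ≤ F w) (hF1 : ∀ w, F w ≤ 1) :
    ∑ u ∈ C, green p C n s u * ∑ w, p u w * |F w - F u| ≤
      Fintype.card S *
        (1 + ∑ u ∈ C, green p C n s u * |∑ w, p u w * (F w - F u)|) := by
  obtain ⟨d, hd1, hd2, hd3⟩ := exists_succ_value F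
  set cross : S → S → S → ℝ := fun v u w =>
    if (F u ≤ F v ∧ F v < F w) ∨ (F w ≤ F v ∧ F v < F u) then d v - F v else 0 with hcross
  have hcross0 : ∀ v u w, 0 ≤ cross v u w := fun v u w => by
    simp only [hcross]
    split_ifs
    exacts [sub_nonneg.2 (hd1 v), le_rfl]
  have habs : ∀ u w, |F w - F u| ≤ ∑ v, cross v u w := by
    intro u w
    refine abs_le'.2 ⟨(hd3 u w).trans ?_, ?_⟩
    · rw [Finset.sum_filter]
      refine Finset.sum_le_sum fun v _ => ?_
      split_ifs with h
      · simp only [hcross, if_pos (Or.inl h)]; exact le_rfl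
      · exact hcross0 v u w
    · rw [neg_sub]
      refine (hd3 w u).trans ?_
      rw [Finset.sum_filter]
      refine Finset.sum_le_sum fun v _ => ?_
      split_ifs with h
      · simp only [hcross, if_pos (Or.inr h)]; exact le_rfl
      · exact hcross0 v u w
  have hv : ∀ v, ∑ u ∈ C, green p C n s u * ∑ w, p u w * cross v u w ≤
      1 + ∑ u ∈ C, green p C n s u * |∑ w, p u w * (F w - F u)| := by
    intro v
    have h1 : ∑ u ∈ C, green p C n s u * (∑ w, p u w * |F w - (F v + d v) / 2| -
        |F u - (F v + d v) / 2|) ≤ 1 := by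
      refine sum_green_mul_sub_le_one hp C n hs (F := fun w => |F w - (F v + d v) / 2|) fun w => ?_
      have h := abs_sub_abs_le_abs_sub (F w - (F v + d v) / 2) (F s - (F v + d v) / 2)
      have h' : |F w - (F v + d v) / 2 - (F s - (F v + d v) / 2)| ≤ 1 := by
        rw [abs_le]
        constructor <;> linarith [hF0 w, hF1 w, hF0 s, hF1 s]
      linarith
    have h2 : ∀ u ∈ C, green p C n s u * ∑ w, p u w * cross v u w ≤
        green p C n s u * (∑ w, p u w * |F w - (F v + d v) / 2| - |F u - (F v + d v) / 2|) +
          green p C n s u * |∑ w, p u w * (F w - F u)| := by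
      intro u _
      rw [← mul_add]
      refine mul_le_mul_of_nonneg_left ?_ (green_nonneg hp C n s u)
      rw [sum_mul_sub_eq hp fun w => |F w - (F v + d v) / 2|]
      have h3 : (if F u ≤ F v then -1 else 1) * ∑ w, p u w * (F w - F u) +
          ∑ w, p u w * cross v u w ≤
          ∑ w, p u w * (|F w - (F v + d v) / 2| - |F u - (F v + d v) / 2|) := by
        rw [Finset.mul_sum, ← Finset.sum_add_distrib]
        refine Finset.sum_le_sum fun w _ => ?_
        rw [mul_left_comm, ← mul_add]
        exact mul_le_mul_of_nonneg_left
          (abs_sub_midpoint (hd1 v) (hd2 v u) (hd2 v w)) (hp.1 u w)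
      have h4 : -|∑ w, p u w * (F w - F u)| ≤
          (if F u ≤ F v then -1 else 1) * ∑ w, p u w * (F w - F u) := by
        split_ifs
        · linarith [le_abs_self (∑ w, p u w * (F w - F u))]
        · linarith [neg_abs_le (∑ w, p u w * (F w - F u))]
      linarith
    have h3 := Finset.sum_le_sum h2
    rw [Finset.sum_add_distrib] at h3
    linarith
  calc ∑ u ∈ C, green p C n s u * ∑ w, p u w * |F w - F u|
      ≤ ∑ u ∈ C, green p C n s u * ∑ w, p u w * ∑ v, cross v u w :=
        Finset.sum_le_sum fun u _ => mul_le_mul_of_nonneg_left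
          (Finset.sum_le_sum fun w _ => mul_le_mul_of_nonneg_left (habs u w) (hp.1 u w))
          (green_nonneg hp C n s u)
    _ = ∑ v, ∑ u ∈ C, green p C n s u * ∑ w, p u w * cross v u w := by
        rw [Finset.sum_comm]
        refine Finset.sum_congr rfl fun u _ => ?_
        rw [← Finset.mul_sum, Finset.sum_comm]
        simp_rw [Finset.mul_sum]
    _ ≤ _ := by
        refine (Finset.sum_le_sum fun v _ => hv v).trans ?_
        rw [Finset.sum_const, nsmul_eq_mul, Finset.card_univ]

lemma card_le_Lconst {T : Type*} [Fintype T] (hcard : 2 ≤ Fintype.card T) : Fintype.card T ≤ Lconst T := by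
  have h := Finset.single_le_sum
    (f := fun n => (Fintype.card T).choose n * n ^ Fintype.card T) (fun _ _ => Nat.zero_le _)
    (Finset.mem_Ico.2 ⟨le_rfl, hcard⟩ : 1 ∈ Finset.Ico 1 (Fintype.card T))
  simpa [Lconst] using h

/-- The exit probabilities of a close chain, extended to all of `S` by their boundary values,
have small total drift under the original chain. -/
lemma sum_green_mul_abs_drift_le {q qh : Matrix S S ℝ} {μ : S → ℝ} {β ε : ℝ}
    (hβ0 : 0 ≤ β) (hε0 : 0 ≤ ε) (hq : IsTransition q) (hqirr : IsIrreducible q)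
    (hμ : IsStationary q μ) (hqh : IsTransition qh) (hclose : IsClose q qh μ (zeta q μ) ε β)
    {C : Finset S} (hC : C.Nonempty) (hC' : C ≠ univ) {s : S} (n : ℕ) {F : S → ℝ}
    (hF0 : ∀ w, 0 ≤ F w) (hF1 : ∀ w, F w ≤ 1) (hF : ∀ u ∈ C, ∑ w, qh u w * F w = F u) :
    ∑ u ∈ C, green q C n s u * |∑ w, q u w * (F w - F u)| ≤
      β * ∑ u ∈ C, green q C n s u * ∑ w, q u w * |F w - F u| +
        Fintype.card S ^ 3 * ε := by
  set z := zeta q μ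
  set N : ℝ := (Fintype.card S : ℝ)
  have hz : 0 < z := zeta_pos hμ hq hqirr hC hC'
  have hN : 0 ≤ N := Nat.cast_nonneg _
  have hpt : ∀ u ∈ C, ∀ w,
      green q C n s u * |q u w - qh u w| ≤ β * (green q C n s u * q u w) + N * ε := by
    intro u hu w
    have hG := green_nonneg hq C n s u
    by_cases h : ε * z ≤ μ u * q u w ∨ ε * z ≤ μ u * qh u w
    · have h1 := mul_le_mul_of_nonneg_left (hclose u w h) hG
      rw [abs_sub_comm]
      have := mul_nonneg hN hε0
      linarith
    · push Not at h
      have h1 : μ u * |q u w - qh u w| ≤ ε * z := by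
        rw [← abs_of_nonneg (hμ.1 u), ← abs_mul, mul_sub, abs_le]
        have h2 := mul_nonneg (hμ.1 u) (hq.1 u w)
        have h3 := mul_nonneg (hμ.1 u) (hqh.1 u w)
        constructor <;> linarith [h.1, h.2]
      have h2 := mul_le_mul_of_nonneg_right (green_le hμ hq hqirr hC hC' n s hu)
        (abs_nonneg (q u w - qh u w))
      have h3 := mul_le_mul_of_nonneg_left h1 hN
      have h4 : z * (green q C n s u * |q u w - qh u w|) ≤ z * (N * ε) := by linarith
      have h5 := le_of_mul_le_mul_left h4 hz
      have := mul_nonneg hβ0 (mul_nonneg hG (hq.1 u w))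
      linarith
  have hrow : ∀ u ∈ C, green q C n s u * |∑ w, q u w * (F w - F u)| ≤
      β * (green q C n s u * ∑ w, q u w * |F w - F u|) + N * (N * ε) := by
    intro u hu
    have h1 : ∑ w, q u w * (F w - F u) = ∑ w, (q u w - qh u w) * (F w - F u) := by
      have h := sum_mul_sub_eq hqh F u
      rw [hF u hu, sub_self] at h
      simp_rw [sub_mul, Finset.sum_sub_distrib]
      linarith
    rw [h1]
    calc _ ≤ green q C n s u * ∑ w, |q u w - qh u w| * |F w - F u| := by
          refine mul_le_mul_of_nonneg_left ?_ (green_nonneg hq C n s u)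
          simp_rw [← abs_mul]
          exact Finset.abs_sum_le_sum_abs _ _
      _ ≤ ∑ w, (β * (green q C n s u * (q u w * |F w - F u|)) + N * ε) := by
          rw [Finset.mul_sum]
          refine Finset.sum_le_sum fun w _ => ?_
          have h2 := mul_le_mul_of_nonneg_right (hpt u hu w) (abs_nonneg (F w - F u))
          have h3 : |F w - F u| ≤ 1 := by
            rw [abs_le]
            constructor <;> linarith [hF0 w, hF1 w, hF0 u, hF1 u]
          have h4 := mul_le_mul_of_nonneg_left h3 (mul_nonneg hN hε0)
          linarith
      _ = _ := by
          rw [Finset.sum_add_distrib, Finset.sum_const, nsmul_eq_mul, Finset.card_univ]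
          simp_rw [Finset.mul_sum]
          rfl
  refine (Finset.sum_le_sum hrow).trans ?_
  rw [Finset.sum_add_distrib, ← Finset.mul_sum, Finset.sum_const, nsmul_eq_mul]
  have h1 : (C.card : ℝ) ≤ N := Nat.cast_le.2 (Finset.card_le_univ C)
  have h2 := mul_le_mul_of_nonneg_right h1 (mul_nonneg hN (mul_nonneg hN hε0))
  linarith

lemma abs_exitProb_sub_le {q : Matrix S S ℝ} {μ : S → ℝ} {η : ℝ} (hq : IsTransition q)
    (hqirr : IsIrreducible q) (hμ : IsStationary q μ) {C : Finset S} (hC' : C ≠ univ) {s t : S}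
    (hs : s ∈ C) (ht : t ∉ C) {F : S → ℝ} (hFt : F t = 1) (hF : ∀ w ∉ C, w ≠ t → F w = 0)
    (hη : ∀ n, ∑ u ∈ C, green q C n s u * |∑ w, q u w * (F w - F u)| ≤ η) :
    |exitProb q C s t - F s| ≤ η := by
  have hzero : ∀ u ∈ C, Filter.Tendsto (fun n => (subMat q C ^ n) s u) Filter.atTop (nhds 0) := by
    intro u hu
    refine Summable.tendsto_atTop_zero (summable_of_sum_range_le
      (c := Fintype.card S * μ u / zeta q μ) (fun n => subMat_pow_nonneg hq C n s u) fun n => ?_)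
    rw [le_div_iff₀ (zeta_pos hμ hq hqirr ⟨s, hs⟩ hC'), mul_comm]
    exact green_le hμ hq hqirr ⟨s, hs⟩ hC' n s hu
  have hlim : Filter.Tendsto (fun n => ∑ u ∈ C, green q C n s u * q u t +
      ∑ u ∈ C, (subMat q C ^ n) s u * F u - F s) Filter.atTop (nhds (exitProb q C s t - F s)) := by
    have h1 := (summable_exit hq C hs ht).hasSum.tendsto_sum_nat
    simp_rw [sum_range_exit] at h1
    have h2 := tendsto_finsetSum C fun u hu => (hzero u hu).mul_const (F u)
    simpa [exitProb] using (h1.add h2).sub_const (F s)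
  refine le_of_tendsto hlim.abs (Filter.Eventually.of_forall fun n => ?_)
  have h1 := sum_green_mul_sub q C n hs F
  have h2 : ∑ w ∈ Cᶜ, (∑ u ∈ C, green q C n s u * q u w) * F w =
      ∑ u ∈ C, green q C n s u * q u t := by
    rw [Finset.sum_eq_single_of_mem t (Finset.mem_compl.2 ht), hFt, mul_one]
    intro w hw hwt
    rw [hF w (Finset.mem_compl.1 hw) hwt, mul_zero]
  rw [h2] at h1
  rw [← h1]
  refine (Finset.abs_sum_le_sum_abs _ _).trans (le_trans (Finset.sum_le_sum fun u _ => ?_) (hη n))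
  rw [abs_mul, abs_of_nonneg (green_nonneg hq C n s u), sum_mul_sub_eq hq]

/-- the exit distributions under `q` and `q̂` are close:
`|Q_{s,q}(t|C) − Q_{s,q̂}(t|C)| < 12βL` for every nonempty proper `C ⊂ S`, `s ∈ C`, `t ∉ C`. -/
theorem perturbed_exit_close
    (hcard : 2 ≤ Fintype.card S)
    (q qh : Matrix S S ℝ) (μ : S → ℝ) (β ε : ℝ)
    (hβ0 : 0 < β) (hβ1 : β < 1 / 2 ^ Fintype.card S)
    (hε0 : 0 < ε)
    (hε1 : ε < β * (1 - β) / ((Lconst S : ℝ) * (Fintype.card S : ℝ) ^ 4))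
    (hq : IsTransition q) (hqirr : IsIrreducible q) (hμ : IsStationary q μ)
    (hqh : IsTransition qh)
    (hclose : IsClose q qh μ (zeta q μ) ε β) :
    ∀ C : Finset S, C.Nonempty → C ≠ Finset.univ → ∀ s ∈ C, ∀ t ∉ C,
      |exitProb q C s t - exitProb qh C s t| < 12 * β * (Lconst S : ℝ) := by
  intro C hC hC' s hs t ht
  set N : ℝ := (Fintype.card S : ℝ) with hNdef
  set L : ℝ := (Lconst S : ℝ)
  have hN2 : 2 ≤ N := Nat.ofNat_le_cast.2 hcard
  have hNL : N ≤ L := Nat.cast_le.2 (card_le_Lconst hcard)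
  have hN0 : 0 < N := by linarith
  have hL0 : 0 < L := by linarith
  have hβN : 2 * (β * N) ≤ 1 := by
    have h1 : Fintype.card S ≤ 2 ^ (Fintype.card S - 1) := by
      have := Nat.lt_two_pow_self (n := Fintype.card S - 1)
      omega
    have h2 : 2 * Fintype.card S ≤ 2 ^ Fintype.card S := by
      calc _ ≤ 2 * 2 ^ (Fintype.card S - 1) := by omega
        _ = 2 ^ Fintype.card S := by rw [← pow_succ']; congr 1; omega
    have h3 : 2 * N ≤ 2 ^ Fintype.card S := by rw [hNdef]; exact_mod_cast h2
    rw [lt_div_iff₀ (by positivity)] at hβ1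
    linarith [mul_le_mul_of_nonneg_left h3 hβ0.le]
  have hε : N ^ 3 * ε ≤ β := by
    rw [lt_div_iff₀ (by positivity)] at hε1
    have h1 : 1 * N ^ 3 ≤ (L * N) * N ^ 3 :=
      mul_le_mul_of_nonneg_right (by nlinarith) (by positivity)
    have h2 := mul_le_mul_of_nonneg_left h1 hε0.le
    nlinarith
  set F : S → ℝ := fun w => if w ∈ C then exitProb qh C w t else if w = t then 1 else 0 with hFdef
  have hFC : ∀ w ∈ C, F w = exitProb qh C w t := fun w hw => if_pos hw
  have hFt : F t = 1 := by simp [hFdef, ht]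
  have hFz : ∀ w ∉ C, w ≠ t → F w = 0 := fun w hw hwt => by simp [hFdef, hw, hwt]
  have hF01 : ∀ w, 0 ≤ F w ∧ F w ≤ 1 := by
    intro w
    by_cases hw : w ∈ C
    · rw [hFC w hw]
      exact ⟨exitProb_nonneg hqh C w t, exitProb_le_one hqh C hw ht⟩
    · by_cases hwt : w = t
      · rw [hwt, hFt]; norm_num
      · rw [hFz w hw hwt]; norm_num
  have hharm : ∀ u ∈ C, ∑ w, qh u w * F w = F u := by
    intro u hu
    rw [hFC u hu, exitProb_eq hqh C hu ht, ← Finset.sum_add_sum_compl C, add_comm]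
    congr 1
    · rw [Finset.sum_eq_single_of_mem t (Finset.mem_compl.2 ht), hFt, mul_one]
      intro w hw hwt
      rw [hFz w (Finset.mem_compl.1 hw) hwt, mul_zero]
    · exact Finset.sum_congr rfl fun w hw => by rw [hFC w hw]
  rw [← hFC s hs]
  refine (abs_exitProb_sub_le (η := 4 * (β * N)) hq hqirr hμ hC' hs ht hFt hFz fun n => ?_).trans_lt ?_
  · have h1 := sum_green_mul_abs_drift_le hβ0.le hε0.le hq hqirr hμ hqh hclose hC hC' (s := s) n
      (fun w => (hF01 w).1) (fun w => (hF01 w).2) hharm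
    have h2 := sum_green_mul_abs_le hq C n hs (fun w => (hF01 w).1) (fun w => (hF01 w).2)
    set D := ∑ u ∈ C, green q C n s u * |∑ w, q u w * (F w - F u)|
    have hD : 0 ≤ D := Finset.sum_nonneg fun u _ =>
      mul_nonneg (green_nonneg hq C n s u) (abs_nonneg _)
    have h3 := mul_le_mul_of_nonneg_left h2 hβ0.le
    have h4 := mul_le_mul_of_nonneg_right hβN hD
    have h5 := mul_le_mul_of_nonneg_left hN2 hβ0.le
    rw [← hNdef] at h1 h3
    linarith
  · have h1 := mul_le_mul_of_nonneg_left hNL hβ0.le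
    have h2 : 0 < β * N := by positivity
    linarith

end PerturbedMC
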